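/- Every Poisson subalgebra of P strictly containing P¹ contains Õ. -/

import Mathlib

open MvPolynomial MeasureTheory

noncomputable section

attribute [local instance] Classical.propDecidable

/-- The Poisson bracket on `ℝ[X₀,X₁,X₂]` associated to the sphere:
`{f,g} = Σ εᵢⱼₖ Xᵢ ∂f/∂Xⱼ ∂g/∂Xₖ` (indices `0,1,2` play the role of `1,2,3`). -/
def pb (f g : MvPolynomial (Fin 3) ℝ) : MvPolynomial (Fin 3) ℝ :=
  X 0 * (pderiv 1 f * pderiv 2 g - pderiv 2 f * pderiv 1 g) +
  X 1 * (pderiv 2 f * pderiv 0 g - pderiv 0 f * pderiv 2 g) +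
  X 2 * (pderiv 0 f * pderiv 1 g - pderiv 1 f * pderiv 0 g)

/-- The ideal generated by `X₀² + X₁² + X₂² - s²`. -/
def sphereIdeal (s : ℝ) : Ideal (MvPolynomial (Fin 3) ℝ) :=
  Ideal.span {X 0 ^ 2 + X 1 ^ 2 + X 2 ^ 2 - C (s ^ 2)}

/-- The Poisson algebra `P` of polynomial functions on the sphere of radius `s`. -/
abbrev SpherePoly (s : ℝ) := MvPolynomial (Fin 3) ℝ ⧸ sphereIdeal s

/-- The quotient map `ℝ[X₀,X₁,X₂] → P`. -/
def toSphere (s : ℝ) : MvPolynomial (Fin 3) ℝ →+* SpherePoly s :=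
  Ideal.Quotient.mk (sphereIdeal s)

/-- The components `S₁, S₂, S₃` of the spin vector (indexed by `Fin 3`). -/
def S (s : ℝ) (i : Fin 3) : SpherePoly s := toSphere s (X i)

/-- A choice of polynomial representative of an element of `P`. -/
def rep (s : ℝ) (p : SpherePoly s) : MvPolynomial (Fin 3) ℝ :=
  (Ideal.Quotient.mk_surjective (I := sphereIdeal s) p).choose

/-- The Poisson bracket descended to `P`.  (It is independent of the choice of
representatives, since the bracket of any polynomial with the generator
`X₀² + X₁² + X₂² - s²` vanishes identically.) -/
def pbS (s : ℝ) (p q : SpherePoly s) : SpherePoly s :=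
  toSphere s (pb (rep s p) (rep s q))

/-- `P¹`, the ℝ-linear span of `{1, S₁, S₂, S₃}` in `P`. -/
def P1 (s : ℝ) : Submodule ℝ (SpherePoly s) :=
  Submodule.span ℝ ({1, S s 0, S s 1, S s 2} : Set (SpherePoly s))

theorem one_mem_P1 (s : ℝ) : (1 : SpherePoly s) ∈ P1 s :=
  Submodule.subset_span (Set.mem_insert _ _)

theorem S_mem_P1 (s : ℝ) (i : Fin 3) : S s i ∈ P1 s := by
  apply Submodule.subset_span
  fin_cases i <;> simp

/-- The Laplacian on `ℝ[X₀,X₁,X₂]` as a linear map. -/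
def laplacian : MvPolynomial (Fin 3) ℝ →ₗ[ℝ] MvPolynomial (Fin 3) ℝ :=
  (pderiv 0).toLinearMap ∘ₗ (pderiv 0).toLinearMap +
  (pderiv 1).toLinearMap ∘ₗ (pderiv 1).toLinearMap +
  (pderiv 2).toLinearMap ∘ₗ (pderiv 2).toLinearMap

/-- Homogeneous harmonic polynomials of degree `l`. -/
def harmonicHomog (l : ℕ) : Submodule ℝ (MvPolynomial (Fin 3) ℝ) :=
  homogeneousSubmodule (Fin 3) ℝ l ⊓ LinearMap.ker laplacian

/-- `H_l`, the image in `P` of the homogeneous harmonic polynomials of degree `l`. -/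
def Hsph (s : ℝ) (l : ℕ) : Submodule ℝ (SpherePoly s) :=
  (harmonicHomog l).map (Ideal.Quotient.mkₐ ℝ (sphereIdeal s)).toLinearMap

/-- `O`, the odd polynomials: the sum of the `H_l` over odd `l`. -/
def Osph (s : ℝ) : Submodule ℝ (SpherePoly s) :=
  ⨆ (l : ℕ) (_ : Odd l), Hsph s l

/-- `Õ = ℝ·1 ⊕ O`. -/
def Otilde (s : ℝ) : Submodule ℝ (SpherePoly s) :=
  Submodule.span ℝ ({1} : Set (SpherePoly s)) ⊔ Osph s

theorem S_mem_H1 (s : ℝ) (i : Fin 3) : S s i ∈ Hsph s 1 := by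
  refine ⟨X i, ⟨isHomogeneous_X _ _, ?_⟩, rfl⟩
  fin_cases i <;> simp [laplacian, pderiv_X]

theorem S_mem_Otilde (s : ℝ) (i : Fin 3) : S s i ∈ Otilde s :=
  Submodule.mem_sup_right
    ((le_iSup₂ (f := fun (l : ℕ) (_ : Odd l) => Hsph s l) 1 odd_one) (S_mem_H1 s i))

theorem one_mem_Otilde (s : ℝ) : (1 : SpherePoly s) ∈ Otilde s :=
  Submodule.mem_sup_left (Submodule.mem_span_singleton_self 1)

section Hamiltonian

variable {K : Type*} [CommRing K]

/-- The Hamiltonian derivation `{p, ·}` of the sphere bracket, over an arbitrary base ring. -/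
def hamiltonian (p : MvPolynomial (Fin 3) K) :
    Derivation K (MvPolynomial (Fin 3) K) (MvPolynomial (Fin 3) K) :=
  (X 1 * pderiv 2 p - X 2 * pderiv 1 p) • pderiv 0 +
  (X 2 * pderiv 0 p - X 0 * pderiv 2 p) • pderiv 1 +
  (X 0 * pderiv 1 p - X 1 * pderiv 0 p) • pderiv 2

theorem hamiltonian_apply (p q : MvPolynomial (Fin 3) K) :
    hamiltonian p q = (X 1 * pderiv 2 p - X 2 * pderiv 1 p) * pderiv 0 q +
      (X 2 * pderiv 0 p - X 0 * pderiv 2 p) * pderiv 1 q +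
      (X 0 * pderiv 1 p - X 1 * pderiv 0 p) * pderiv 2 q := rfl

theorem hamiltonian_add_left (p p' q : MvPolynomial (Fin 3) K) :
    hamiltonian (p + p') q = hamiltonian p q + hamiltonian p' q := by
  simp only [hamiltonian_apply, map_add]; ring

theorem hamiltonian_mul_left (p p' q : MvPolynomial (Fin 3) K) :
    hamiltonian (p * p') q = p * hamiltonian p' q + p' * hamiltonian p q := by
  simp only [hamiltonian_apply, Derivation.leibniz, smul_eq_mul]; ring

theorem hamiltonian_C_left (a : K) (q : MvPolynomial (Fin 3) K) :
    hamiltonian (C a) q = 0 := by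
  simp [hamiltonian_apply]

theorem hamiltonian_pow_left (p q : MvPolynomial (Fin 3) K) (n : ℕ) :
    hamiltonian (p ^ n) q = C (n : K) * p ^ (n - 1) * hamiltonian p q := by
  simp only [hamiltonian_apply, Derivation.leibniz_pow, smul_eq_mul, nsmul_eq_mul, map_natCast]
  ring

theorem hamiltonian_map {L : Type*} [CommRing L] (φ : K →+* L) (p q : MvPolynomial (Fin 3) K) :
    map φ (hamiltonian p q) = hamiltonian (map φ p) (map φ q) := by
  simp [hamiltonian_apply, pderiv_map]

/-- The defining polynomial of the sphere is a Casimir: its bracket with everything vanishes. -/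
theorem hamiltonian_casimir_left (c : K) (q : MvPolynomial (Fin 3) K) :
    hamiltonian (X 0 ^ 2 + X 1 ^ 2 + X 2 ^ 2 - C c) q = 0 := by
  simp [hamiltonian_apply, Derivation.leibniz_pow, pderiv_X]
  ring

theorem hamiltonian_casimir_right (c : K) (p : MvPolynomial (Fin 3) K) :
    hamiltonian p (X 0 ^ 2 + X 1 ^ 2 + X 2 ^ 2 - C c) = 0 := by
  simp [hamiltonian_apply, Derivation.leibniz_pow, pderiv_X]
  ring

end Hamiltonian

section Ladder

/-- The coordinate `z = X₀ + i X₁` of weight one. -/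
def zVar : MvPolynomial (Fin 3) ℂ := X 0 + C Complex.I * X 1

/-- The coordinate `w = X₀ - i X₁` of weight minus one. -/
def wVar : MvPolynomial (Fin 3) ℂ := X 0 - C Complex.I * X 1

/-- The coordinate `h = X₂` of weight zero. -/
def hVar : MvPolynomial (Fin 3) ℂ := X 2

theorem C_I_mul_C_I : (C Complex.I * C Complex.I : MvPolynomial (Fin 3) ℂ) = -1 := by
  rw [← C_mul, Complex.I_mul_I, C_neg, C_1]

/-- The raising operator `-i {z, ·}`. -/
def raising : Derivation ℂ (MvPolynomial (Fin 3) ℂ) (MvPolynomial (Fin 3) ℂ) :=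
  (-Complex.I) • hamiltonian zVar

/-- The lowering operator `i {w, ·}`. -/
def lowering : Derivation ℂ (MvPolynomial (Fin 3) ℂ) (MvPolynomial (Fin 3) ℂ) :=
  Complex.I • hamiltonian wVar

/-- The weight operator `i {h, ·}`. -/
def weightOp : Derivation ℂ (MvPolynomial (Fin 3) ℂ) (MvPolynomial (Fin 3) ℂ) :=
  Complex.I • hamiltonian hVar

theorem raising_z : raising zVar = 0 := by
  simp [raising, hamiltonian_apply, zVar, pderiv_X]

theorem raising_w : raising wVar = -2 * hVar := by
  simp [raising, hamiltonian_apply, zVar, wVar, hVar, pderiv_X, smul_eq_C_mul]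
  linear_combination (2 * X 2) * C_I_mul_C_I

theorem raising_h : raising hVar = zVar := by
  simp [raising, hamiltonian_apply, zVar, hVar, pderiv_X, smul_eq_C_mul]
  linear_combination (-X 0) * C_I_mul_C_I

theorem lowering_z : lowering zVar = -2 * hVar := by
  simp [lowering, hamiltonian_apply, zVar, wVar, hVar, pderiv_X, smul_eq_C_mul]
  linear_combination (2 * X 2) * C_I_mul_C_I

theorem lowering_w : lowering wVar = 0 := by
  simp [lowering, hamiltonian_apply, wVar, pderiv_X]

theorem lowering_h : lowering hVar = wVar := by
  simp [lowering, hamiltonian_apply, wVar, hVar, pderiv_X, smul_eq_C_mul]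
  linear_combination (-X 0) * C_I_mul_C_I

theorem weightOp_z : weightOp zVar = zVar := by
  simp [weightOp, hamiltonian_apply, zVar, hVar, pderiv_X, smul_eq_C_mul]
  linear_combination (-X 0) * C_I_mul_C_I

theorem weightOp_w : weightOp wVar = -wVar := by
  simp [weightOp, hamiltonian_apply, wVar, hVar, pderiv_X, smul_eq_C_mul]
  linear_combination (X 0) * C_I_mul_C_I

theorem weightOp_h : weightOp hVar = 0 := by
  simp [weightOp, hamiltonian_apply, hVar, pderiv_X]

/-- The defining polynomial of the complex sphere in ladder coordinates. -/
def sphereRel (r : ℂ) : MvPolynomial (Fin 3) ℂ := zVar * wVar + hVar ^ 2 - C r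

theorem sphereRel_eq (r : ℂ) : sphereRel r = X 0 ^ 2 + X 1 ^ 2 + X 2 ^ 2 - C r := by
  simp only [sphereRel, zVar, wVar, hVar]
  linear_combination (-X 1 ^ 2) * C_I_mul_C_I

theorem map_conj_zVar : map (starRingEnd ℂ) zVar = wVar := by
  simp [zVar, wVar, sub_eq_add_neg]

theorem map_conj_wVar : map (starRingEnd ℂ) wVar = zVar := by
  simp [zVar, wVar]

theorem map_conj_hVar : map (starRingEnd ℂ) hVar = hVar := by
  simp [hVar]

/-- Complex subspaces that contain the multiples of `sphereRel r` and are closed under the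
bracket with their elements, under conjugation, and contain `P¹`. -/
structure IsSphereSubalgebra (r : ℂ) (V : Submodule ℂ (MvPolynomial (Fin 3) ℂ)) : Prop where
  mul_rel_mem : ∀ q, q * sphereRel r ∈ V
  z_mem : zVar ∈ V
  w_mem : wVar ∈ V
  h_mem : hVar ∈ V
  hamiltonian_mem : ∀ p ∈ V, ∀ q ∈ V, hamiltonian p q ∈ V
  conj_mem : ∀ p ∈ V, map (starRingEnd ℂ) p ∈ V

theorem C_mul_mem (V : Submodule ℂ (MvPolynomial (Fin 3) ℂ)) (a : ℂ)
    {p : MvPolynomial (Fin 3) ℂ} (hp : p ∈ V) : C a * p ∈ V := by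
  rw [← smul_eq_C_mul]; exact V.smul_mem a hp

theorem mem_of_C_mul_mem (V : Submodule ℂ (MvPolynomial (Fin 3) ℂ)) {a : ℂ} (ha : a ≠ 0)
    {p : MvPolynomial (Fin 3) ℂ} (hp : C a * p ∈ V) : p ∈ V := by
  rw [← smul_eq_C_mul] at hp; exact (V.smul_mem_iff ha).1 hp

variable {r : ℂ} {V : Submodule ℂ (MvPolynomial (Fin 3) ℂ)}

theorem derivation_C_mul (D : Derivation ℂ (MvPolynomial (Fin 3) ℂ) (MvPolynomial (Fin 3) ℂ))
    (a : ℂ) (p : MvPolynomial (Fin 3) ℂ) : D (C a * p) = C a * D p := by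
  rw [← smul_eq_C_mul, D.map_smul, smul_eq_C_mul]

theorem lowering_raising_z_pow_mul_w_pow (j : ℕ) :
    lowering (raising (zVar ^ (j + 2) * wVar ^ (j + 1))) =
      C (4 * ((j : ℂ) + 1) * (j + 2)) * (zVar ^ (j + 1) * wVar ^ j * hVar ^ 2) -
      C (2 * ((j : ℂ) + 1)) * (zVar ^ (j + 2) * wVar ^ (j + 1)) := by
  have h1 : raising (zVar ^ (j + 2) * wVar ^ (j + 1)) =
      C (-2 * ((j : ℂ) + 1)) * (zVar ^ (j + 2) * wVar ^ j * hVar) := by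
    simp only [Derivation.leibniz, Derivation.leibniz_pow, raising_z, raising_w, smul_eq_mul,
      nsmul_eq_mul, Nat.add_sub_cancel, map_mul, map_add, map_natCast, map_one, map_neg,
      map_ofNat]
    push_cast
    ring
  rw [h1, derivation_C_mul]
  simp only [Derivation.leibniz, Derivation.leibniz_pow, lowering_z, lowering_w, lowering_h,
    smul_eq_mul, nsmul_eq_mul, map_mul, map_add, map_natCast, map_one, map_neg,
    map_ofNat, show j + 2 - 1 = j + 1 from rfl]
  push_cast
  ring

namespace IsSphereSubalgebra

theorem raising_mem (hV : IsSphereSubalgebra r V) {p} (hp : p ∈ V) : raising p ∈ V :=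
  V.smul_mem _ (hV.hamiltonian_mem _ hV.z_mem _ hp)

theorem lowering_mem (hV : IsSphereSubalgebra r V) {p} (hp : p ∈ V) : lowering p ∈ V :=
  V.smul_mem _ (hV.hamiltonian_mem _ hV.w_mem _ hp)

theorem weightOp_mem (hV : IsSphereSubalgebra r V) {p} (hp : p ∈ V) : weightOp p ∈ V :=
  V.smul_mem _ (hV.hamiltonian_mem _ hV.h_mem _ hp)

theorem z_pow_mul_raising_mem (hV : IsSphereSubalgebra r V) {n : ℕ} {p}
    (hz : zVar ^ (n + 1) ∈ V) (hp : p ∈ V) : zVar ^ n * raising p ∈ V := by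
  have h1 := hV.hamiltonian_mem _ hz _ hp
  rw [hamiltonian_pow_left, Nat.add_sub_cancel, mul_assoc] at h1
  have h2 := mem_of_C_mul_mem V (Nat.cast_ne_zero.2 n.succ_ne_zero) h1
  have h3 : zVar ^ n * raising p = C (-Complex.I) * (zVar ^ n * hamiltonian zVar p) := by
    rw [raising, Derivation.smul_apply, smul_eq_C_mul]; ring
  rw [h3]
  exact C_mul_mem V _ h2

/-- Two-term descent along the Casimir operator on vectors of weight one. -/
theorem z_sq_mul_w_mem_of_two_term (hV : IsSphereSubalgebra r V) (hr : r ≠ 0) (j : ℕ) :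
    ∀ a b : ℂ, 2 * (j + 1) * (j + 2) * a + (2 * j + 7) * j * b ≠ 0 →
      C a * (zVar ^ (j + 2) * wVar ^ (j + 1)) + C (b * r) * (zVar ^ (j + 1) * wVar ^ j) ∈ V →
      zVar ^ 2 * wVar ∈ V := by
  induction j with
  | zero =>
    intro a b hab hmem
    have h1 : C a * (zVar ^ 2 * wVar) ∈ V := by
      have := V.sub_mem hmem (C_mul_mem V (b * r) hV.z_mem)
      convert this using 1
      ring
    exact mem_of_C_mul_mem V (fun h => hab (by simp [h])) h1
  | succ j ih =>
    intro a b hab hmem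
    refine ih (4 * (j + 2) * (j + 3) * a + (8 * (j + 2) + 2) * b)
      (4 * (j + 1) * (j + 2) * b) ?_ ?_
    · have hj1 : ((j : ℂ) + 1) ≠ 0 := by exact_mod_cast j.succ_ne_zero
      have hj2 : ((j : ℂ) + 2) ≠ 0 := by exact_mod_cast (j + 1).succ_ne_zero
      have := mul_ne_zero (mul_ne_zero (mul_ne_zero (by norm_num : (4 : ℂ) ≠ 0) hj1) hj2) hab
      convert this using 1
      push_cast
      ring
    · apply mem_of_C_mul_mem V hr
      have h1 := V.add_mem (hV.lowering_mem (hV.raising_mem hmem))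
        (C_mul_mem V (2 * (j + 2) * (2 * (j + 2) + 3)) hmem)
      have h2 := V.sub_mem h1 (hV.mul_rel_mem
        (C (4 * (j + 2) * (j + 3) * a) * (zVar ^ (j + 2) * wVar ^ (j + 1))
          + C (4 * (j + 1) * (j + 2) * b * r) * (zVar ^ (j + 1) * wVar ^ j)))
      convert h2 using 1
      rw [map_add raising, map_add lowering, derivation_C_mul, derivation_C_mul, derivation_C_mul,
        derivation_C_mul, lowering_raising_z_pow_mul_w_pow, lowering_raising_z_pow_mul_w_pow,
        sphereRel]
      simp only [map_mul, map_add, map_natCast, map_one, map_ofNat]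
      push_cast
      ring

theorem mem_of_eq_add_mul_rel (hV : IsSphereSubalgebra r V) {p p' : MvPolynomial (Fin 3) ℂ}
    (q : MvPolynomial (Fin 3) ℂ) (h : p = p' + q * sphereRel r) (hp' : p' ∈ V) : p ∈ V := by
  rw [h]; exact V.add_mem hp' (hV.mul_rel_mem q)

theorem w_pow_mem (hV : IsSphereSubalgebra r V) {l : ℕ} (hz : zVar ^ l ∈ V) : wVar ^ l ∈ V := by
  simpa [map_conj_zVar] using hV.conj_mem _ hz

/-- A power `z ^ l` with `l ≥ 2` produces `z ^ 3`. -/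
theorem z_cube_mem (hV : IsSphereSubalgebra r V) (hr : r ≠ 0) {j : ℕ}
    (hz : zVar ^ (j + 2) ∈ V) : zVar ^ 3 ∈ V := by
  have h1 : wVar ^ (j + 1) * hVar ∈ V := by
    have h := hV.raising_mem (hV.w_pow_mem hz)
    refine mem_of_C_mul_mem V (a := -2 * ((j : ℂ) + 2)) ?_ ?_
    · exact mul_ne_zero (by norm_num) (by exact_mod_cast (j + 1).succ_ne_zero)
    · convert h using 1
      simp only [Derivation.leibniz_pow, raising_w, smul_eq_mul, nsmul_eq_mul, map_mul, map_add,
        map_natCast, map_neg, map_ofNat, show j + 2 - 1 = j + 1 from rfl]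
      push_cast
      ring
  have h2 : zVar ^ 2 * wVar ∈ V := by
    refine hV.z_sq_mul_w_mem_of_two_term hr j (2 * j + 3) (-2 * (j + 1)) ?_ ?_
    · have : ((j : ℂ) + 1) ≠ 0 := by exact_mod_cast j.succ_ne_zero
      convert mul_ne_zero (by norm_num : (12 : ℂ) ≠ 0) this using 1
      ring
    · have h := hV.z_pow_mul_raising_mem (n := j + 1) hz h1
      refine hV.mem_of_eq_add_mul_rel (C (2 * ((j : ℂ) + 1)) * (zVar ^ (j + 1) * wVar ^ j)) ?_ h
      simp only [Derivation.leibniz, Derivation.leibniz_pow, raising_w, raising_h, sphereRel,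
        smul_eq_mul, nsmul_eq_mul, map_mul, map_add, map_natCast, map_neg, map_ofNat, map_one,
        Nat.add_sub_cancel]
      push_cast
      ring
  have h3 : zVar * hVar ^ 2 ∈ V :=
    hV.mem_of_eq_add_mul_rel zVar (by rw [sphereRel]; ring)
      (V.sub_mem (C_mul_mem V r hV.z_mem) h2)
  have h4 : zVar ^ 2 * hVar ∈ V := by
    refine mem_of_C_mul_mem V (two_ne_zero' ℂ) ?_
    convert hV.raising_mem h3 using 1
    simp only [Derivation.leibniz, Derivation.leibniz_pow, raising_z, raising_h, smul_eq_mul,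
      nsmul_eq_mul, map_ofNat]
    push_cast
    ring
  convert hV.raising_mem h4 using 1
  simp only [Derivation.leibniz, Derivation.leibniz_pow, raising_z, raising_h, smul_eq_mul,
    smul_zero, mul_zero, add_zero]
  ring

theorem z_pow_odd_mem (hV : IsSphereSubalgebra r V) (hz : zVar ^ 3 ∈ V) (k : ℕ) :
    zVar ^ (2 * k + 1) ∈ V := by
  induction k with
  | zero => simpa using hV.z_mem
  | succ k ih =>
    have h1 : zVar ^ (2 * k) * hVar ∈ V := by
      have h := hV.lowering_mem ih
      refine mem_of_C_mul_mem V (a := -2 * ((2 * k + 1 : ℕ) : ℂ)) ?_ ?_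
      · exact mul_ne_zero (by norm_num) (Nat.cast_ne_zero.2 (Nat.succ_ne_zero _))
      · convert h using 1
        simp only [Derivation.leibniz_pow, lowering_z, smul_eq_mul, nsmul_eq_mul, map_mul,
          map_natCast, map_neg, map_ofNat, Nat.add_sub_cancel]
        ring
    have h2 := hV.z_pow_mul_raising_mem (n := 2) hz h1
    convert h2 using 1
    simp only [Derivation.leibniz, Derivation.leibniz_pow, raising_z, raising_h, smul_eq_mul,
      smul_zero, mul_zero, add_zero]
    ring

theorem z_pow_mul_h_pow_mem (hV : IsSphereSubalgebra r V) (hz : zVar ^ 3 ∈ V) (c : ℕ) :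
    ∀ m : ℕ, Odd (m + c) → zVar ^ m * hVar ^ c ∈ V := by
  induction c using Nat.twoStepInduction with
  | zero =>
    rintro m ⟨k, hk⟩
    have : m = 2 * k + 1 := hk
    simpa [this] using hV.z_pow_odd_mem hz k
  | one =>
    intro m hm
    have h := hV.lowering_mem (hV.z_pow_odd_mem hz (m / 2))
    have h2 : 2 * (m / 2) = m := by
      obtain ⟨k, hk⟩ := hm
      omega
    rw [h2] at h
    refine mem_of_C_mul_mem V (a := -2 * ((m + 1 : ℕ) : ℂ)) ?_ ?_
    · exact mul_ne_zero (by norm_num) (Nat.cast_ne_zero.2 (Nat.succ_ne_zero _))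
    · convert h using 1
      simp only [Derivation.leibniz_pow, lowering_z, smul_eq_mul, nsmul_eq_mul, map_mul,
        map_natCast, map_neg, map_ofNat, Nat.add_sub_cancel]
      ring
  | more c ih0 ih1 =>
    intro m hm
    have h0 := ih0 m (by rw [← add_assoc] at hm; exact (Nat.odd_add.1 hm).2 even_two)
    have h1 := hV.lowering_mem (ih1 (m + 1) (by convert hm using 1; ring))
    refine mem_of_C_mul_mem V (a := -((2 * m + 3 + c : ℕ) : ℂ)) ?_ ?_
    · exact neg_ne_zero.2 (Nat.cast_ne_zero.2 (by omega))
    · refine hV.mem_of_eq_add_mul_rel (-(C ((c : ℂ) + 1) * (zVar ^ m * hVar ^ c))) ?_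
        (V.sub_mem h1 (C_mul_mem V ((c + 1) * r) h0))
      simp only [Derivation.leibniz, Derivation.leibniz_pow, lowering_z, lowering_h, sphereRel,
        smul_eq_mul, nsmul_eq_mul, map_mul, map_add, map_natCast, map_neg, map_one,
        Nat.add_sub_cancel]
      push_cast
      ring

theorem w_pow_mul_h_pow_mem (hV : IsSphereSubalgebra r V) (hz : zVar ^ 3 ∈ V) {m c : ℕ}
    (h : Odd (m + c)) : wVar ^ m * hVar ^ c ∈ V := by
  simpa [map_conj_zVar, map_conj_hVar] using hV.conj_mem _ (hV.z_pow_mul_h_pow_mem hz c m h)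

end IsSphereSubalgebra

/-- Modulo the sphere relation, mixed monomials reduce to those without a factor `z * w`. -/
theorem z_pow_mul_w_pow_mul_h_pow_mem (hrel : ∀ q, q * sphereRel r ∈ V) (Q : ℕ → Prop)
    (hQ : ∀ n, Q (n + 2) → Q n)
    (hz : ∀ m c, Q (m + c) → zVar ^ m * hVar ^ c ∈ V)
    (hw : ∀ m c, Q (m + c) → wVar ^ m * hVar ^ c ∈ V) (a : ℕ) :
    ∀ b c, Q (a + b + c) → zVar ^ a * wVar ^ b * hVar ^ c ∈ V := by
  induction a with
  | zero =>
    intro b c h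
    simpa using hw b c (by simpa using h)
  | succ a ih =>
    rintro (_ | b) c h
    · simpa using hz (a + 1) c h
    · have h2 := ih b (c + 2) (by convert h using 1; ring)
      have h0 := ih b c (hQ _ (by convert h using 1; ring))
      have := V.add_mem (V.sub_mem (C_mul_mem V r h0) h2)
        (hrel (zVar ^ a * wVar ^ b * hVar ^ c))
      convert this using 1
      rw [sphereRel]
      ring

theorem X_zero_eq : (X 0 : MvPolynomial (Fin 3) ℂ) = C (1 / 2) * (zVar + wVar) := by
  have h : (C (1 / 2) * C 2 : MvPolynomial (Fin 3) ℂ) = 1 := by rw [← C_mul]; simp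
  simp only [zVar, wVar]
  rw [map_ofNat] at h
  linear_combination (-X 0) * h

theorem X_one_eq : (X 1 : MvPolynomial (Fin 3) ℂ) = C (-Complex.I / 2) * (zVar - wVar) := by
  have h : (C (-Complex.I / 2) * (C 2 * C Complex.I) : MvPolynomial (Fin 3) ℂ) = 1 := by
    rw [← C_mul, ← C_mul, ← C_1]
    congr 1
    linear_combination -Complex.I_mul_I
  simp only [zVar, wVar]
  rw [map_ofNat] at h
  linear_combination (-X 1) * h

/-- Monomials of degree `n` in the `X i` lie in any subspace containing those in `z, w, h`. -/
theorem X_pow_mul_mem {n k i j : ℕ}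
    (hzwh : ∀ a b c, a + b + c = n → zVar ^ a * wVar ^ b * hVar ^ c ∈ V) :
    i + j + k = n → (X 0 ^ i * X 1 ^ j * X 2 ^ k : MvPolynomial (Fin 3) ℂ) ∈ V := by
  suffices H : ∀ a b, a + b + i + j + k = n →
      zVar ^ a * wVar ^ b * (X 0 ^ i * X 1 ^ j * X 2 ^ k) ∈ V from
    fun h => by simpa using H 0 0 (by simpa using h)
  induction i with
  | zero =>
    induction j with
    | zero => intro a b h; simpa [hVar] using hzwh a b k (by simpa using h)
    | succ j ih =>
      intro a b h
      have := C_mul_mem V (-Complex.I / 2)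
        (V.sub_mem (ih (a + 1) b (by omega)) (ih a (b + 1) (by omega)))
      convert this using 1
      rw [pow_succ (X 1) j]
      nth_rw 2 [X_one_eq]
      ring
  | succ i ih =>
    intro a b h
    have := C_mul_mem V (1 / 2)
      (V.add_mem (ih (a + 1) b (by omega)) (ih a (b + 1) (by omega)))
    convert this using 1
    rw [pow_succ (X 0) i]
    nth_rw 2 [X_zero_eq]
    ring

theorem mem_of_isHomogeneous {n : ℕ}
    (hzwh : ∀ a b c, a + b + c = n → zVar ^ a * wVar ^ b * hVar ^ c ∈ V)
    {p : MvPolynomial (Fin 3) ℂ} (hp : p.IsHomogeneous n) : p ∈ V := by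
  rw [p.as_sum]
  refine V.sum_mem fun d hd => ?_
  rw [monomial_eq, Finsupp.prod_fintype _ _ (fun i => pow_zero _), Fin.prod_univ_three]
  refine C_mul_mem V _ (X_pow_mul_mem hzwh ?_)
  have := hp (mem_support_iff.1 hd)
  rw [← this, Finsupp.weight_apply, Finsupp.sum_fintype _ _ (by simp), Fin.sum_univ_three]
  simp

/-- If a derivation `D` kills `x` and sends `h` to `x`, then applying it repeatedly to
`x ^ n * q(h)` yields a power of `x`. -/
theorem pow_add_natDegree_mem
    {D : Derivation ℂ (MvPolynomial (Fin 3) ℂ) (MvPolynomial (Fin 3) ℂ)}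
    {x : MvPolynomial (Fin 3) ℂ} (hx : D x = 0) (hh : D hVar = x)
    (hD : ∀ p ∈ V, D p ∈ V) {d : ℕ} : ∀ {n : ℕ} {q : Polynomial ℂ}, q ≠ 0 → q.natDegree = d →
      x ^ n * Polynomial.aeval hVar q ∈ V → x ^ (n + d) ∈ V := by
  induction d with
  | zero =>
    intro n q hq hd hmem
    obtain ⟨c, rfl⟩ := Polynomial.natDegree_eq_zero.1 hd
    rw [Polynomial.aeval_C, mul_comm] at hmem
    exact mem_of_C_mul_mem V (fun h => hq (by simp [h])) hmem
  | succ d ih =>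
    intro n q hq hd hmem
    have hd' : q.derivative.natDegree = d := by
      rw [Polynomial.natDegree_derivative, hd, Nat.add_sub_cancel]
    have hq' : q.derivative ≠ 0 := fun h => by
      have := Polynomial.derivative_eq_zero.1 h
      omega
    rw [show n + (d + 1) = n + 1 + d by ring]
    refine ih hq' hd' ?_
    convert hD _ hmem using 1
    rw [Derivation.leibniz, Derivation.leibniz_pow, hx, Derivation.map_aeval, hh]
    simp only [smul_eq_mul, smul_zero, mul_zero, add_zero]
    ring

/-- The weight vectors of weight `n` attached to polynomials in `h`. -/
def weightVec (n : ℤ) : Polynomial ℂ →ₗ[ℂ] MvPolynomial (Fin 3) ℂ :=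
  LinearMap.mulLeft ℂ (zVar ^ n.toNat * wVar ^ (-n).toNat) ∘ₗ
    (Polynomial.aeval hVar).toLinearMap

theorem weightVec_apply (n : ℤ) (q : Polynomial ℂ) :
    weightVec n q = zVar ^ n.toNat * wVar ^ (-n).toNat * Polynomial.aeval hVar q := rfl

theorem derivation_pow_of_eigen {D : Derivation ℂ (MvPolynomial (Fin 3) ℂ) (MvPolynomial (Fin 3) ℂ)}
    {x : MvPolynomial (Fin 3) ℂ} {a : ℂ} (hx : D x = C a * x) (n : ℕ) :
    D (x ^ n) = C (n * a) * x ^ n := by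
  induction n with
  | zero => simp
  | succ n ih =>
    rw [pow_succ, Derivation.leibniz, ih, hx]
    simp only [smul_eq_mul, map_mul, map_natCast]
    push_cast
    ring

theorem weightOp_weightVec (n : ℤ) (q : Polynomial ℂ) :
    weightOp (weightVec n q) = (n : ℂ) • weightVec n q := by
  have hz := derivation_pow_of_eigen (D := weightOp) (x := zVar) (a := 1)
    (by simp [weightOp_z]) n.toNat
  have hw := derivation_pow_of_eigen (D := weightOp) (x := wVar) (a := -1)
    (by simp [weightOp_w]) (-n).toNat
  have hn : (n : ℂ) = (n.toNat : ℂ) - ((-n).toNat : ℂ) := by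
    exact_mod_cast (Int.toNat_sub_toNat_neg n).symm
  rw [weightVec_apply, Derivation.leibniz, Derivation.leibniz, Derivation.map_aeval, hz, hw,
    weightOp_h, smul_eq_C_mul, hn]
  simp only [smul_eq_mul, map_mul, map_natCast, map_sub, map_neg, map_one]
  ring

/-- A subspace stable under an endomorphism contains the components of any of its elements
that is a sum of eigenvectors. -/
theorem mem_of_sum_eigenvectors_mem {K M : Type*} [Field K] [CharZero K] [AddCommGroup M]
    [Module K M] {T : M →ₗ[K] M} {U : Submodule K M} (hT : ∀ x ∈ U, T x ∈ U) (t : Finset ℤ) :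
    ∀ g : ℤ → M, (∀ n, T (g n) = (n : K) • g n) → ∑ n ∈ t, g n ∈ U → ∀ n ∈ t, g n ∈ U := by
  induction t using Finset.induction_on with
  | empty => simp
  | insert m t hm ih =>
    intro g hg hsum
    have hrest : ∀ n ∈ t, g n ∈ U := by
      have h1 : ∑ n ∈ t, ((n : K) - m) • g n ∈ U := by
        convert U.sub_mem (hT _ hsum) (U.smul_mem (m : K) hsum) using 1
        rw [map_sum, Finset.smul_sum, ← Finset.sum_sub_distrib, Finset.sum_insert hm, hg, sub_self,
          zero_add]
        exact Finset.sum_congr rfl fun n _ => by rw [hg, sub_smul]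
      intro n hn
      have h2 := ih (fun n => ((n : K) - m) • g n)
        (fun n => by rw [map_smul, hg, smul_comm]) h1 n hn
      refine (U.smul_mem_iff (sub_ne_zero.2 ?_)).1 h2
      exact fun h => hm (Int.cast_injective h ▸ hn)
    intro n hn
    rcases Finset.mem_insert.1 hn with rfl | hn
    · rw [Finset.sum_insert hm] at hsum
      exact (U.add_mem_iff_left (U.sum_mem hrest)).1 hsum
    · exact hrest n hn

/-- Modulo the sphere relation every polynomial is a sum of weight vectors. -/
theorem rel_sup_iSup_weightVec_eq_top (r : ℂ) :
    (Ideal.span {sphereRel r}).restrictScalars ℂ ⊔ ⨆ n, LinearMap.range (weightVec n) = ⊤ := by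
  set U := (Ideal.span {sphereRel r}).restrictScalars ℂ ⊔ ⨆ n, LinearMap.range (weightVec n)
    with hU
  have hvec : ∀ n q, weightVec n q ∈ U := fun n q =>
    Submodule.mem_sup_right (Submodule.mem_iSup_of_mem n ⟨q, rfl⟩)
  have hmon : ∀ a b c : ℕ, zVar ^ a * wVar ^ b * hVar ^ c ∈ U := by
    intro a b c
    refine z_pow_mul_w_pow_mul_h_pow_mem (r := r) ?_ (fun _ => True) (fun _ _ => trivial) ?_ ?_ a b c
      trivial
    · exact fun q => Submodule.mem_sup_left
        (Ideal.mul_mem_left _ q (Ideal.mem_span_singleton_self _))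
    · intro m c _
      simpa [weightVec_apply] using hvec m (Polynomial.X ^ c)
    · intro m c _
      simpa [weightVec_apply] using hvec (-m) (Polynomial.X ^ c)
  refine eq_top_iff.2 fun p _ => ?_
  rw [← sum_homogeneousComponent p]
  exact U.sum_mem fun n _ => mem_of_isHomogeneous (fun a b c _ => hmon a b c)
    (homogeneousComponent_isHomogeneous n p)

/-- A weight vector of degree at most one is a combination of `1`, `x` and `h`. -/
theorem pow_mul_aeval_h_mem_of_le {U : Submodule ℂ (MvPolynomial (Fin 3) ℂ)}
    {x : MvPolynomial (Fin 3) ℂ} (h1 : 1 ∈ U) (hx : x ∈ U) (hh : hVar ∈ U) {n : ℕ}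
    {q : Polynomial ℂ} (hq : n + q.natDegree ≤ 1) : x ^ n * Polynomial.aeval hVar q ∈ U := by
  rcases Nat.eq_zero_or_pos n with rfl | hn
  · rw [q.eq_X_add_C_of_natDegree_le_one (by omega)]
    simpa using U.add_mem (C_mul_mem U (q.coeff 1) hh) (C_mul_mem U (q.coeff 0) h1)
  · obtain rfl : n = 1 := by omega
    obtain ⟨c, rfl⟩ := Polynomial.natDegree_eq_zero.1 (show q.natDegree = 0 by omega)
    simpa [mul_comm] using C_mul_mem U c hx

theorem IsSphereSubalgebra.le_or_z_cube_mem (hV : IsSphereSubalgebra r V) (hr : r ≠ 0)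
    {U : Submodule ℂ (MvPolynomial (Fin 3) ℂ)} (hrel : ∀ q, q * sphereRel r ∈ U) (h1 : 1 ∈ U)
    (hz : zVar ∈ U) (hw : wVar ∈ U) (hh : hVar ∈ U) : V ≤ U ∨ zVar ^ 3 ∈ V := by
  by_contra! hcon
  obtain ⟨hle, hcube⟩ := hcon
  have hpow : ∀ l, zVar ^ l ∈ V → l ≤ 1 := by
    intro l hl
    by_contra! hlt
    obtain ⟨j, rfl⟩ := Nat.exists_eq_add_of_le' (show 2 ≤ l from hlt)
    exact hcube (hV.z_cube_mem hr hl)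
  have hvec : ∀ n q, weightVec n q ∈ V → weightVec n q ∈ U := by
    intro n q hmem
    rcases eq_or_ne q 0 with rfl | hq
    · simp
    rcases Int.eq_nat_or_neg n with ⟨m, rfl | rfl⟩ <;>
      simp only [weightVec_apply, Int.toNat_natCast, Int.toNat_neg_natCast, neg_neg, pow_zero,
        mul_one, one_mul] at hmem ⊢
    · exact pow_mul_aeval_h_mem_of_le h1 hz hh (hpow _
        (pow_add_natDegree_mem raising_z raising_h (fun _ => hV.raising_mem) hq rfl hmem))
    · refine pow_mul_aeval_h_mem_of_le h1 hw hh (hpow _ ?_)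
      simpa [map_conj_wVar] using hV.conj_mem _
        (pow_add_natDegree_mem lowering_w lowering_h (fun _ => hV.lowering_mem) hq rfl hmem)
  refine hle fun p hp => ?_
  have htop : p ∈ (Ideal.span {sphereRel r}).restrictScalars ℂ ⊔
      ⨆ n, LinearMap.range (weightVec n) := by
    rw [rel_sup_iSup_weightVec_eq_top]; trivial
  obtain ⟨j, hj, g, hg, rfl⟩ := Submodule.mem_sup.1 htop
  obtain ⟨q, rfl⟩ := Ideal.mem_span_singleton'.1 hj
  obtain ⟨f, hf, rfl⟩ := (Submodule.mem_iSup_iff_exists_finsupp _ _).1 hg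
  have hsum : ∑ n ∈ f.support, f n ∈ V := (V.add_mem_iff_right (hV.mul_rel_mem q)).1 hp
  refine U.add_mem (hrel q) (U.sum_mem fun n hn => ?_)
  have hmem := mem_of_sum_eigenvectors_mem (T := weightOp.toLinearMap)
    (fun _ => hV.weightOp_mem) f.support f (fun n => by
      obtain ⟨q, hq⟩ := hf n
      rw [← hq]
      exact weightOp_weightVec n q) hsum n hn
  obtain ⟨q, hq⟩ := hf n
  rw [← hq] at hmem ⊢
  exact hvec n q hmem

end Ladder

section Complexification

/-- The complexification of a real subspace of `ℝ[X₀,X₁,X₂]`, inside `ℂ[X₀,X₁,X₂]`. -/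
def complexify (D : Submodule ℝ (MvPolynomial (Fin 3) ℝ)) :
    Submodule ℂ (MvPolynomial (Fin 3) ℂ) where
  carrier := {p | ∃ f ∈ D, ∃ g ∈ D,
    p = map Complex.ofRealHom f + C Complex.I * map Complex.ofRealHom g}
  zero_mem' := ⟨0, D.zero_mem, 0, D.zero_mem, by simp⟩
  add_mem' := by
    rintro _ _ ⟨f, hf, g, hg, rfl⟩ ⟨f', hf', g', hg', rfl⟩
    exact ⟨f + f', D.add_mem hf hf', g + g', D.add_mem hg hg', by simp only [map_add]; ring⟩
  smul_mem' := by
    rintro a _ ⟨f, hf, g, hg, rfl⟩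
    refine ⟨a.re • f - a.im • g, D.sub_mem (D.smul_mem _ hf) (D.smul_mem _ hg),
      a.re • g + a.im • f, D.add_mem (D.smul_mem _ hg) (D.smul_mem _ hf), ?_⟩
    conv_lhs => rw [← Complex.re_add_im a]
    simp only [smul_eq_C_mul, map_add, map_sub, map_mul, map_C, Complex.ofRealHom_eq_coe]
    linear_combination (-C (a.im : ℂ) * map Complex.ofRealHom g) * -C_I_mul_C_I

variable {D : Submodule ℝ (MvPolynomial (Fin 3) ℝ)}

theorem map_mem_complexify {f : MvPolynomial (Fin 3) ℝ} (hf : f ∈ D) :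
    map Complex.ofRealHom f ∈ complexify D :=
  ⟨f, hf, 0, D.zero_mem, by simp⟩

theorem map_mem_complexify_iff {f : MvPolynomial (Fin 3) ℝ} :
    map Complex.ofRealHom f ∈ complexify D ↔ f ∈ D := by
  refine ⟨?_, map_mem_complexify⟩
  rintro ⟨g, hg, g', -, h⟩
  suffices f = g from this ▸ hg
  ext d
  have := congrArg (fun p => (coeff d p).re) h
  simpa [coeff_map, coeff_C_mul] using this

theorem complexify_top : complexify ⊤ = ⊤ := by
  refine eq_top_iff.2 fun p _ => ?_
  rw [p.as_sum]
  refine Submodule.sum_mem _ fun d _ => ?_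
  have h : map Complex.ofRealHom (monomial d 1) ∈ complexify ⊤ := map_mem_complexify trivial
  have := (complexify ⊤).smul_mem (coeff d p) h
  simpa [smul_monomial] using this

variable {c : ℝ}

theorem map_rel_eq_sphereRel :
    map Complex.ofRealHom (X 0 ^ 2 + X 1 ^ 2 + X 2 ^ 2 - C c) = sphereRel c := by
  simp [sphereRel_eq]

theorem mul_sphereRel_mem_complexify (hrel : ∀ q, q * (X 0 ^ 2 + X 1 ^ 2 + X 2 ^ 2 - C c) ∈ D)
    (q : MvPolynomial (Fin 3) ℂ) : q * sphereRel c ∈ complexify D := by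
  obtain ⟨f, -, g, -, rfl⟩ : q ∈ complexify ⊤ := by rw [complexify_top]; trivial
  refine ⟨_, hrel f, _, hrel g, ?_⟩
  simp only [map_mul, map_rel_eq_sphereRel]
  ring

theorem X_mem_complexify (hX : ∀ i, X i ∈ D) (i : Fin 3) : X i ∈ complexify D := by
  simpa using map_mem_complexify (hX i)

theorem zVar_mem_complexify (hX : ∀ i, X i ∈ D) : zVar ∈ complexify D :=
  Submodule.add_mem _ (X_mem_complexify hX 0) (C_mul_mem _ _ (X_mem_complexify hX 1))

theorem wVar_mem_complexify (hX : ∀ i, X i ∈ D) : wVar ∈ complexify D :=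
  Submodule.sub_mem _ (X_mem_complexify hX 0) (C_mul_mem _ _ (X_mem_complexify hX 1))

theorem isSphereSubalgebra_complexify
    (hrel : ∀ q, q * (X 0 ^ 2 + X 1 ^ 2 + X 2 ^ 2 - C c) ∈ D)
    (hX : ∀ i, X i ∈ D) (hD : ∀ f ∈ D, ∀ g ∈ D, hamiltonian f g ∈ D) :
    IsSphereSubalgebra (c : ℂ) (complexify D) where
  mul_rel_mem := mul_sphereRel_mem_complexify hrel
  z_mem := zVar_mem_complexify hX
  w_mem := wVar_mem_complexify hX
  h_mem := X_mem_complexify hX 2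
  hamiltonian_mem := by
    rintro _ ⟨f, hf, g, hg, rfl⟩ _ ⟨f', hf', g', hg', rfl⟩
    refine ⟨_, D.sub_mem (hD f hf f' hf') (hD g hg g' hg'),
      _, D.add_mem (hD f hf g' hg') (hD g hg f' hf'), ?_⟩
    simp only [map_add, map_sub, hamiltonian_add_left, hamiltonian_mul_left, hamiltonian_C_left,
      derivation_C_mul, hamiltonian_map]
    linear_combination hamiltonian (map Complex.ofRealHom g) (map Complex.ofRealHom g') *
      C_I_mul_C_I
  conj_mem := by
    rintro _ ⟨f, hf, g, hg, rfl⟩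
    refine ⟨f, hf, -g, D.neg_mem hg, ?_⟩
    have hconj : (starRingEnd ℂ).comp Complex.ofRealHom = Complex.ofRealHom := by
      ext x; simp
    simp [map_map, hconj]

/-- The polynomial form of the main result: a bracket-closed space of polynomials containing the
sphere ideal and the coordinates, but not contained in the span of these and `1`, contains all
homogeneous polynomials of odd degree. -/
theorem isHomogeneous_odd_mem (hc : c ≠ 0) {U : Submodule ℝ (MvPolynomial (Fin 3) ℝ)}
    (hrel : ∀ q, q * (X 0 ^ 2 + X 1 ^ 2 + X 2 ^ 2 - C c) ∈ D) (hX : ∀ i, X i ∈ D)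
    (hD : ∀ f ∈ D, ∀ g ∈ D, hamiltonian f g ∈ D)
    (hrelU : ∀ q, q * (X 0 ^ 2 + X 1 ^ 2 + X 2 ^ 2 - C c) ∈ U) (hXU : ∀ i, X i ∈ U)
    (h1U : 1 ∈ U) (hDU : ¬ D ≤ U) {l : ℕ} (hl : Odd l) {f : MvPolynomial (Fin 3) ℝ}
    (hf : f.IsHomogeneous l) : f ∈ D := by
  have hV := isSphereSubalgebra_complexify hrel hX hD
  have hcube : zVar ^ 3 ∈ complexify D := by
    refine (hV.le_or_z_cube_mem (Complex.ofReal_ne_zero.2 hc)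
      (mul_sphereRel_mem_complexify hrelU) ?_ (zVar_mem_complexify hXU)
      (wVar_mem_complexify hXU) (X_mem_complexify hXU 2)).resolve_left ?_
    · simpa using map_mem_complexify h1U
    · exact fun hle => hDU fun g hg => map_mem_complexify_iff.1 (hle (map_mem_complexify hg))
  refine map_mem_complexify_iff.1 (mem_of_isHomogeneous (n := l) (fun a b k h => ?_) (hf.map _))
  exact z_pow_mul_w_pow_mul_h_pow_mem hV.mul_rel_mem Odd
    (fun n hn => (Nat.odd_add.1 hn).2 even_two)
    (fun m c h => hV.z_pow_mul_h_pow_mem hcube c m h) (fun m c h => hV.w_pow_mul_h_pow_mem hcube h)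
    a b k (h ▸ hl)

end Complexification

theorem pb_eq_hamiltonian (f g : MvPolynomial (Fin 3) ℝ) : pb f g = hamiltonian f g := by
  rw [pb, hamiltonian_apply]; ring

theorem toSphere_mul_rel (s : ℝ) (q : MvPolynomial (Fin 3) ℝ) :
    toSphere s (q * (X 0 ^ 2 + X 1 ^ 2 + X 2 ^ 2 - C (s ^ 2))) = 0 :=
  Ideal.Quotient.eq_zero_iff_mem.2 (Ideal.mul_mem_left _ q (Ideal.mem_span_singleton_self _))

theorem exists_rep_toSphere_eq (s : ℝ) (f : MvPolynomial (Fin 3) ℝ) :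
    ∃ q, rep s (toSphere s f) = f + q * (X 0 ^ 2 + X 1 ^ 2 + X 2 ^ 2 - C (s ^ 2)) := by
  have h : toSphere s (rep s (toSphere s f)) = toSphere s f :=
    (Ideal.Quotient.mk_surjective (I := sphereIdeal s) (toSphere s f)).choose_spec
  obtain ⟨q, hq⟩ := Ideal.mem_span_singleton'.1 (Ideal.Quotient.eq.1 h)
  exact ⟨q, by rw [hq]; ring⟩

/-- The bracket on `P` is computed on arbitrary representatives. -/
theorem pbS_toSphere (s : ℝ) (f g : MvPolynomial (Fin 3) ℝ) :
    pbS s (toSphere s f) (toSphere s g) = toSphere s (hamiltonian f g) := by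
  obtain ⟨a, ha⟩ := exists_rep_toSphere_eq s f
  obtain ⟨b, hb⟩ := exists_rep_toSphere_eq s g
  rw [pbS, pb_eq_hamiltonian, ha, hb]
  rw [← sub_eq_zero, ← map_sub,
    ← toSphere_mul_rel s (hamiltonian a g + hamiltonian f b +
      (X 0 ^ 2 + X 1 ^ 2 + X 2 ^ 2 - C (s ^ 2)) * hamiltonian a b)]
  congr 1
  rw [hamiltonian_add_left, hamiltonian_mul_left, hamiltonian_casimir_left, map_add, map_add,
    Derivation.leibniz, Derivation.leibniz, hamiltonian_casimir_right, hamiltonian_casimir_right]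
  simp only [smul_eq_mul]
  ring

/-- Lemma 2.9: every Poisson subalgebra of `P` strictly containing `P¹` contains `Õ`. -/
theorem Otilde_le_of_gt_P1 (s : ℝ) (hs : 0 < s)
    (Cs : Submodule ℝ (SpherePoly s))
    (hpoisson : ∀ p ∈ Cs, ∀ q ∈ Cs, pbS s p q ∈ Cs)
    (h : P1 s < Cs) :
    Otilde s ≤ Cs := by
  let φ : MvPolynomial (Fin 3) ℝ →ₗ[ℝ] SpherePoly s :=
    (Ideal.Quotient.mkₐ ℝ (sphereIdeal s)).toLinearMap
  have hker : ∀ (U : Submodule ℝ (SpherePoly s)) q,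
      q * (X 0 ^ 2 + X 1 ^ 2 + X 2 ^ 2 - C (s ^ 2)) ∈ U.comap φ := fun U q => by
    change toSphere s _ ∈ U
    rw [toSphere_mul_rel]
    exact U.zero_mem
  refine sup_le ?_ (iSup₂_le fun l hl => Submodule.map_le_iff_le_comap.2 fun f hf => ?_)
  · rw [Submodule.span_singleton_le_iff_mem]
    exact h.le (one_mem_P1 s)
  · refine isHomogeneous_odd_mem (D := Cs.comap φ) (U := (P1 s).comap φ) (pow_pos hs 2).ne'
      (hker Cs) (fun i => h.le (S_mem_P1 s i)) (fun f hf g hg => ?_) (hker _) (S_mem_P1 s)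
      (one_mem_P1 s) (fun hle => ?_) hl hf.1
    · change toSphere s _ ∈ Cs
      rw [← pbS_toSphere]
      exact hpoisson _ hf _ hg
    · refine h.not_ge fun p hp => ?_
      obtain ⟨f, rfl⟩ := Ideal.Quotient.mk_surjective p
      exact hle hp

end
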